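/- arXiv:math/0507567 — 4 statements merged into one kernel-verified Lean document; each statement's English description precedes it below -/
import Mathlib

section
/- Fix n ≥ 2 and lengths l₁,…,l_{n−1} > 0, and consider the truck-with-trailers vector fields h₁, h₂ on U = { y ∈ ℝⁿ : cos y_k ≠ 0 for k = 2,…,n }. Then for every i with 1 ≤ i ≤ n and every j with i < j ≤ n, the function S_i = L_{h₁}^{i−1} y₁ satisfies ∂S_i/∂y_j = 0 on U; that is, S_i depends only on the coordinates y₁, …, y_i. -/
open Set

/-- The `k`-th coordinate (1-based, as in the paper) of `y ∈ ℝⁿ`. -/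
noncomputable def coord {n : ℕ} (y : EuclideanSpace ℝ (Fin n)) (k : ℕ) : ℝ :=
  if h : k - 1 < n then y ⟨k - 1, h⟩ else 0

/-- `σ_i(y₂, …, y_i) = ∏_{k=2}^i sec y_k` (so `σ₁ ≡ 1`). -/
noncomputable def sigmaFun {n : ℕ} (i : ℕ) (y : EuclideanSpace ℝ (Fin n)) : ℝ :=
  ∏ k ∈ Finset.Icc 2 i, (Real.cos (coord y k))⁻¹

/-- `η₁(y₂) = l₁⁻¹ tan y₂` and
`η_i(y₂, …, y_{i+1}) = (l_i⁻¹ tan y_{i+1} − l_{i-1}⁻¹ sin y_i)·σ_i` for `i ≥ 2`. -/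
noncomputable def etaFun {n : ℕ} (l : ℕ → ℝ) (i : ℕ)
    (y : EuclideanSpace ℝ (Fin n)) : ℝ :=
  if i = 1 then (l 1)⁻¹ * Real.tan (coord y 2)
  else ((l i)⁻¹ * Real.tan (coord y (i + 1)) - (l (i - 1))⁻¹ * Real.sin (coord y i)) *
    sigmaFun i y

/-- Lie derivative of a scalar function `φ` along a vector field `h` on `ℝⁿ`. -/
noncomputable def lieDeriv {n : ℕ} (h : EuclideanSpace ℝ (Fin n) → EuclideanSpace ℝ (Fin n))
    (φ : EuclideanSpace ℝ (Fin n) → ℝ) : EuclideanSpace ℝ (Fin n) → ℝ :=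
  fun y => fderiv ℝ φ y (h y)

/-- Repeated Lie derivatives. -/
noncomputable def lieIter {n : ℕ} (h : EuclideanSpace ℝ (Fin n) → EuclideanSpace ℝ (Fin n))
    (φ : EuclideanSpace ℝ (Fin n) → ℝ) : ℕ → EuclideanSpace ℝ (Fin n) → ℝ
  | 0 => φ
  | (i + 1) => lieDeriv h (lieIter h φ i)

open scoped ContDiff

/-- The open set on which `cos y_k ≠ 0` for `k = 2, …, n`. -/
def cosDomain (n : ℕ) : Set (EuclideanSpace ℝ (Fin n)) :=
  {y | ∀ k, 2 ≤ k → k ≤ n → Real.cos (coord y k) ≠ 0}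

theorem contDiff_coord {n : ℕ} (k : ℕ) :
    ContDiff ℝ ∞ (fun y : EuclideanSpace ℝ (Fin n) => coord y k) := by
  unfold coord
  split_ifs <;> fun_prop

theorem isOpen_cosDomain (n : ℕ) : IsOpen (cosDomain n) := by
  have h : cosDomain n = ⋂ k ∈ Finset.Icc 2 n, {y | Real.cos (coord y k) ≠ 0} := by
    ext y
    simp [cosDomain]
  rw [h]
  exact isOpen_biInter_finset fun k _ =>
    isOpen_ne_fun (Real.continuous_cos.comp (contDiff_coord k).continuous) continuous_const

theorem contDiffAt_tan_coord {n k : ℕ} {y : EuclideanSpace ℝ (Fin n)}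
    (hy : Real.cos (coord y k) ≠ 0) :
    ContDiffAt ℝ ∞ (fun z : EuclideanSpace ℝ (Fin n) => Real.tan (coord z k)) y :=
  ContDiffAt.comp (g := Real.tan) y (Real.contDiffAt_tan.2 hy) (contDiff_coord k).contDiffAt

theorem contDiffAt_sigmaFun {n i : ℕ} (hi : i ≤ n) {y : EuclideanSpace ℝ (Fin n)}
    (hy : y ∈ cosDomain n) : ContDiffAt ℝ ∞ (sigmaFun i) y := by
  unfold sigmaFun
  refine contDiffAt_prod fun k hk => ?_
  rw [Finset.mem_Icc] at hk
  exact ((contDiff_coord k).cos.contDiffAt).inv (hy k hk.1 (hk.2.trans hi))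

theorem contDiffAt_etaFun {n i : ℕ} (l : ℕ → ℝ) (hi : 1 ≤ i) (hin : i < n)
    {y : EuclideanSpace ℝ (Fin n)} (hy : y ∈ cosDomain n) :
    ContDiffAt ℝ ∞ (etaFun l i) y := by
  unfold etaFun
  split_ifs with h
  · exact contDiffAt_const.mul (contDiffAt_tan_coord (hy 2 le_rfl (by omega)))
  · exact ((contDiffAt_const.mul (contDiffAt_tan_coord (hy (i + 1) (by omega) hin))).sub
      (contDiffAt_const.mul (contDiff_coord i).sin.contDiffAt)).mul
      (contDiffAt_sigmaFun hin.le hy)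

theorem coord_add_smul_single {n k : ℕ} (y : EuclideanSpace ℝ (Fin n)) {j : Fin n}
    (hkj : k - 1 ≠ j) (t : ℝ) :
    coord (y + t • EuclideanSpace.single j (1 : ℝ)) k = coord y k := by
  unfold coord
  split_ifs with h
  · simp [Fin.ext_iff, hkj]
  · rfl

theorem etaFun_add_smul_single {n i : ℕ} (l : ℕ → ℝ) (y : EuclideanSpace ℝ (Fin n))
    {j : Fin n} (hi : 1 ≤ i) (hij : i < j) (t : ℝ) :
    etaFun l i (y + t • EuclideanSpace.single j (1 : ℝ)) = etaFun l i y := by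
  have hc : ∀ k ≤ i + 1, coord (y + t • EuclideanSpace.single j (1 : ℝ)) k = coord y k :=
    fun k hk => coord_add_smul_single y (by omega) t
  have hs : sigmaFun i (y + t • EuclideanSpace.single j (1 : ℝ)) = sigmaFun i y :=
    Finset.prod_congr rfl fun k hk => by rw [hc k (by rw [Finset.mem_Icc] at hk; omega)]
  unfold etaFun
  rw [hc 2 (by omega), hc (i + 1) le_rfl, hc i (by omega), hs]

theorem fderiv_apply_eq_zero_of_forall_add_smul {E F : Type*} [NormedAddCommGroup E]
    [NormedSpace ℝ E] [NormedAddCommGroup F] [NormedSpace ℝ F] {f : E → F} {x v : E}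
    (h : ∀ t : ℝ, f (x + t • v) = f x) : fderiv ℝ f x v = 0 := by
  by_cases hf : DifferentiableAt ℝ f x
  · rw [← hf.lineDeriv_eq_fderiv]
    simp [lineDeriv, h]
  · simp [fderiv_zero_of_not_differentiableAt hf]

theorem map_eq_zero_of_forall_single {n : ℕ} {F : Type*} [AddCommGroup F] [Module ℝ F]
    [TopologicalSpace F] (A : EuclideanSpace ℝ (Fin n) →L[ℝ] F) (w : EuclideanSpace ℝ (Fin n))
    (h : ∀ k, w k = 0 ∨ A (EuclideanSpace.single k 1) = 0) : A w = 0 := by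
  have hw := (EuclideanSpace.basisFun (Fin n) ℝ).sum_repr w
  rw [← hw, map_sum]
  refine Finset.sum_eq_zero fun k _ => ?_
  rw [map_smul]
  rcases h k with h | h <;> simp [h]

theorem ContDiffOn.lieDeriv {n : ℕ} {U : Set (EuclideanSpace ℝ (Fin n))} (hU : IsOpen U)
    {h : EuclideanSpace ℝ (Fin n) → EuclideanSpace ℝ (Fin n)}
    {φ : EuclideanSpace ℝ (Fin n) → ℝ} (hh : ContDiffOn ℝ ∞ h U) (hφ : ContDiffOn ℝ ∞ φ U) :
    ContDiffOn ℝ ∞ (lieDeriv h φ) U :=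
  (hφ.fderiv_of_isOpen hU (by simp)).clm_apply hh

/-- If `∂φ/∂v` vanishes on `U`, then `∂(L_h φ)/∂v` is the derivative of `φ` along `∂h/∂v`. -/
theorem fderiv_lieDeriv_apply_of_fderiv_apply_eq_zero {n : ℕ}
    {U : Set (EuclideanSpace ℝ (Fin n))} (hU : IsOpen U)
    {h : EuclideanSpace ℝ (Fin n) → EuclideanSpace ℝ (Fin n)}
    {φ : EuclideanSpace ℝ (Fin n) → ℝ} (hh : ContDiffOn ℝ ∞ h U) (hφ : ContDiffOn ℝ ∞ φ U)
    {v : EuclideanSpace ℝ (Fin n)} (hv : ∀ y ∈ U, fderiv ℝ φ y v = 0)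
    {y : EuclideanSpace ℝ (Fin n)} (hy : y ∈ U) :
    fderiv ℝ (lieDeriv h φ) y v = fderiv ℝ φ y (fderiv ℝ h y v) := by
  have hφy : ContDiffAt ℝ ∞ φ y := hφ.contDiffAt (hU.mem_nhds hy)
  have hdφ : DifferentiableAt ℝ (fderiv ℝ φ) y :=
    (hφy.fderiv_right (m := ∞) (by simp)).differentiableAt (by simp)
  have hdh : DifferentiableAt ℝ h y :=
    (hh.contDiffAt (hU.mem_nhds hy)).differentiableAt (by simp)
  have hsymm : IsSymmSndFDerivAt ℝ φ y :=
    hφy.isSymmSndFDerivAt (by simpa using WithTop.coe_le_coe.2 (le_top : (2 : ℕ∞) ≤ ⊤))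
  have hzero : fderiv ℝ (fun z => fderiv ℝ φ z v) y = 0 := by
    have : (fun z => fderiv ℝ φ z v) =ᶠ[nhds y] fun _ => 0 :=
      Filter.eventuallyEq_of_mem (hU.mem_nhds hy) hv
    rw [this.fderiv_eq]
    simp
  have hsnd : fderiv ℝ (fderiv ℝ φ) y v (h y) = 0 := by
    rw [hsymm v (h y)]
    rw [fderiv_clm_apply hdφ (differentiableAt_const v)] at hzero
    simpa using congrArg (fun A => A (h y)) hzero
  unfold lieDeriv
  rw [fderiv_clm_apply hdφ hdh]
  simp [hsnd]

/-- Triangular structure of the chained coordinates of the truck with trailers: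
`S_i = L_{h₁}^{i-1} y₁` does not depend on the coordinates `y_j`, `j > i`, on
`U = { y : cos y_k ≠ 0, k = 2, …, n }`. -/
theorem stmt13 {n : ℕ} (hn : 2 ≤ n)
    (l : ℕ → ℝ) (hl : ∀ i, 1 ≤ i → i ≤ n - 1 → 0 < l i)
    (h₁ h₂ : EuclideanSpace ℝ (Fin n) → EuclideanSpace ℝ (Fin n))
    (hh₁ : ∀ y (j : Fin n), h₁ y j = if (j : ℕ) < n - 1 then etaFun l ((j : ℕ) + 1) y else 0)
    (hh₂ : ∀ y (j : Fin n), h₂ y j = if (j : ℕ) = n - 1 then 1 else 0)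
    (y₁ : EuclideanSpace ℝ (Fin n) → ℝ) (hy₁ : ∀ y, y₁ y = y ⟨0, by omega⟩) :
    ∀ i j : ℕ, ∀ _hi : 1 ≤ i, ∀ _hij : i < j, ∀ _hjn : j ≤ n,
      ∀ y : EuclideanSpace ℝ (Fin n),
        (∀ k, 2 ≤ k → k ≤ n → Real.cos (coord y k) ≠ 0) →
        fderiv ℝ (lieIter h₁ y₁ (i - 1)) y (EuclideanSpace.single ⟨j - 1, by omega⟩ 1) = 0 := by
  have hU := isOpen_cosDomain n
  have hcomp : ∀ k : Fin n, (fun y => h₁ y k) =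
      if (k : ℕ) < n - 1 then etaFun l ((k : ℕ) + 1) else fun _ => 0 := by
    intro k
    ext y
    rw [hh₁]
    split_ifs <;> rfl
  have hsmooth : ContDiffOn ℝ ∞ h₁ (cosDomain n) := by
    refine contDiffOn_euclidean.2 fun k y hy => ContDiffAt.contDiffWithinAt ?_
    rw [hcomp]
    split_ifs
    · exact contDiffAt_etaFun l (by omega) (by omega) hy
    · exact contDiffAt_const
  have hdh : ∀ (k j : Fin n), (k : ℕ) + 1 < j → ∀ y ∈ cosDomain n,
      (fderiv ℝ h₁ y (EuclideanSpace.single j 1)) k = 0 := by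
    intro k j hkj y hy
    have hd : DifferentiableAt ℝ h₁ y :=
      (hsmooth.contDiffAt (hU.mem_nhds hy)).differentiableAt (by simp)
    have hk := ((EuclideanSpace.proj (𝕜 := ℝ) k).hasFDerivAt.comp y hd.hasFDerivAt).fderiv
    have hz : fderiv ℝ (EuclideanSpace.proj (𝕜 := ℝ) k ∘ h₁) y
        (EuclideanSpace.single j 1) = 0 := by
      refine fderiv_apply_eq_zero_of_forall_add_smul fun t => ?_
      simp only [Function.comp_apply, PiLp.proj_apply, hh₁]
      rw [etaFun_add_smul_single l y (by omega) hkj]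
    rw [hk] at hz
    simpa using hz
  have key : ∀ i : ℕ, ContDiffOn ℝ ∞ (lieIter h₁ y₁ i) (cosDomain n) ∧
      ∀ j : Fin n, i < j → ∀ y ∈ cosDomain n,
        fderiv ℝ (lieIter h₁ y₁ i) y (EuclideanSpace.single j 1) = 0 := by
    intro i
    induction i with
    | zero =>
      refine ⟨?_, fun j hj y _ => fderiv_apply_eq_zero_of_forall_add_smul fun t => ?_⟩
      · rw [lieIter, funext hy₁]
        fun_prop
      · have : (⟨0, by omega⟩ : Fin n) ≠ j := fun h => by simp [← h] at hj
        simp [lieIter, hy₁, this]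
    | succ i ih =>
      obtain ⟨hφ, hi⟩ := ih
      refine ⟨hsmooth.lieDeriv hU hφ, fun j hj y hy => ?_⟩
      rw [lieIter, fderiv_lieDeriv_apply_of_fderiv_apply_eq_zero hU hsmooth hφ
        (hi j (by omega)) hy]
      refine map_eq_zero_of_forall_single _ _ fun k => ?_
      rcases lt_or_ge i (k : ℕ) with hk | hk
      · exact Or.inr (hi k hk y hy)
      · exact Or.inl (hdh k j (by omega) y hy)
  intro i j hi hij hjn y hy
  exact (key (i - 1)).2 ⟨j - 1, by omega⟩ (by simp only; omega) y hy
end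

section
/- Let ψ, ψ⁺ ∈ ℝ, l > 0, ω ∈ ℝ, and for θ ∈ ℝ write τ(θ) = (cos θ, sin θ) and ν(θ) = (−sin θ, cos θ) ∈ ℝ². Let a, a⁺ ∈ ℝ² satisfy ⟨a, ν(ψ)⟩ = 0, ⟨a⁺, ν(ψ⁺)⟩ = 0, and a⁺ = a + l·ω·ν(ψ). Set υ = ⟨a, τ(ψ)⟩ and υ⁺ = ⟨a⁺, τ(ψ⁺)⟩. If cos(ψ⁺ − ψ) ≠ 0, then ω = υ·l⁻¹·tan(ψ⁺ − ψ) and υ⁺ = υ / cos(ψ⁺ − ψ). -/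
/-- The single-joint step in the derivation of the truck-with-trailers kinematics:
from the rolling constraints `⟨a, ν(ψ)⟩ = 0`, `⟨a⁺, ν(ψ⁺)⟩ = 0` and the differentiated
hitch constraint `a⁺ = a + lω ν(ψ)`, if `cos(ψ⁺ − ψ) ≠ 0` then
`ω = υ l⁻¹ tan(ψ⁺ − ψ)` and `υ⁺ = υ / cos(ψ⁺ − ψ)`, where `υ = ⟨a, τ(ψ)⟩`,
`υ⁺ = ⟨a⁺, τ(ψ⁺)⟩`, `τ(θ) = (cos θ, sin θ)`, `ν(θ) = (−sin θ, cos θ)`. -/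
theorem stmt17 (ψ ψp l ω : ℝ) (hl : 0 < l)
    (a₁ a₂ ap₁ ap₂ : ℝ)
    -- rolling-without-slipping constraints
    (hroll : a₁ * (-Real.sin ψ) + a₂ * Real.cos ψ = 0)
    (hrollp : ap₁ * (-Real.sin ψp) + ap₂ * Real.cos ψp = 0)
    -- differentiated hitch constraint `a⁺ = a + l ω ν(ψ)`
    (hhitch₁ : ap₁ = a₁ + l * ω * (-Real.sin ψ))
    (hhitch₂ : ap₂ = a₂ + l * ω * Real.cos ψ)
    (υ υp : ℝ)
    (hυ : υ = a₁ * Real.cos ψ + a₂ * Real.sin ψ)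
    (hυp : υp = ap₁ * Real.cos ψp + ap₂ * Real.sin ψp)
    (hcos : Real.cos (ψp - ψ) ≠ 0) :
    ω = υ * l⁻¹ * Real.tan (ψp - ψ) ∧ υp = υ / Real.cos (ψp - ψ) := by
  have pyth := Real.sin_sq_add_cos_sq ψ
  have ha₁ : a₁ = υ * Real.cos ψ := by
    linear_combination (-Real.sin ψ) * hroll - Real.cos ψ * hυ - a₁ * pyth
  have ha₂ : a₂ = υ * Real.sin ψ := by
    linear_combination Real.cos ψ * hroll - Real.sin ψ * hυ - a₂ * pyth
  have hlω : l * ω * Real.cos (ψp - ψ) = υ * Real.sin (ψp - ψ) := by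
    rw [hhitch₁, hhitch₂, ha₁, ha₂] at hrollp
    rw [Real.cos_sub, Real.sin_sub]
    linear_combination hrollp
  have hυp' : υp = υ * Real.cos (ψp - ψ) + l * ω * Real.sin (ψp - ψ) := by
    rw [hυp, hhitch₁, hhitch₂, ha₁, ha₂, Real.cos_sub, Real.sin_sub]
    ring
  constructor
  · rw [Real.tan_eq_sin_div_cos]
    field_simp
    linear_combination hlω
  · rw [eq_div_iff hcos]
    linear_combination Real.cos (ψp - ψ) * hυp' + Real.sin (ψp - ψ) * hlω +
      υ * Real.sin_sq_add_cos_sq (ψp - ψ)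
end

section
/- There exists a continuous feedback map Φ : ℝ³ × ℝ³ × { u ∈ ℝ² : u₁ ≠ 0 } → ℝ² with the following property. Let x^D ∈ C²([0,∞), ℝ²) satisfy inf_{t≥0} |ẋ^D(t)| > 0 with ẋ^D and ẍ^D bounded on [0,∞); let ε ∈ {−1,1}, set u₁^D(t) = ε|ẋ^D(t)|, let y₁^D ∈ C¹([0,∞), ℝ) be any function with ẋ^D(t) = u₁^D(t)·(cos y₁^D(t), sin y₁^D(t)) for all t, and set u₂^D = ẏ₁^D. Then for every initial state (x₁(0), x₂(0), y₁(0)) ∈ ℝ³, the closed-loop solution of the Chaplygin sled system ẋ₁ = u₁ cos y₁, ẋ₂ = u₁ sin y₁, ẏ₁ = u₂, with u(t) = Φ((x₁(t), x₂(t), y₁(t)), (x₁^D(t), x₂^D(t), y₁^D(t)), u^D(t)), exists for all t ≥ 0, the input u is bounded, and x(t) − x^D(t) → 0, y₁(t) − y₁^D(t) → 0, u(t) − u^D(t) → 0 as t → ∞. -/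
open Set Filter

/-- The cardinal sine is smooth. -/
lemma exists_contDiff_mul_eq_sin :
    ∃ s : ℝ → ℝ, ContDiff ℝ 1 s ∧ (∀ x, x * s x = Real.sin x) ∧ s 0 = 1 := by
  have hd : Differentiable ℂ (dslope Complex.sin 0) := by
    rw [← differentiableOn_univ, Complex.differentiableOn_dslope univ_mem]
    exact Complex.differentiable_sin.differentiableOn
  refine ⟨fun x => (dslope Complex.sin 0 (x : ℂ)).re, hd.contDiff.real_of_complex, fun x => ?_, ?_⟩
  · have h := congrArg Complex.re (sub_smul_dslope Complex.sin 0 (x : ℂ))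
    simpa [← Complex.ofReal_sin] using h
  · simp [dslope_same]

/-- A bounded, globally Lipschitz, time-continuous vector field has a global solution. -/
lemma exists_forall_hasDerivAt_of_bounded_lipschitz {E : Type*} [NormedAddCommGroup E]
    [NormedSpace ℝ E] [CompleteSpace E] {F : ℝ → E → E} {K L : NNReal}
    (hK : ∀ t, LipschitzWith K (F t)) (hc : ∀ x, Continuous fun t => F t x)
    (hL : ∀ t x, ‖F t x‖ ≤ L) (z₀ : E) :
    ∃ z : ℝ → E, z 0 = z₀ ∧ ∀ t, HasDerivAt z (F t (z t)) t := by
  have local_sol : ∀ n : ℕ, ∃ z : ℝ → E, z 0 = z₀ ∧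
      ∀ t ∈ Ioo (-(n + 1 : ℝ)) (n + 1), HasDerivAt z (F t (z t)) t := by
    intro n
    have hn : (0 : ℝ) ≤ n := n.cast_nonneg
    have hpl : IsPicardLindelof F (tmin := -(n + 1 : ℝ)) (tmax := n + 1)
        ⟨0, by constructor <;> linarith⟩ z₀ (L * (n + 1)) 0 L K := by
      refine ⟨fun t _ => (hK t).lipschitzOnWith, fun x _ => (hc x).continuousOn,
        fun t _ x _ => hL t x, ?_⟩
      simp
    obtain ⟨z, hz0, hz⟩ := hpl.exists_eq_forall_mem_Icc_hasDerivWithinAt₀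
    exact ⟨z, hz0, fun t ht =>
      (hz t (Ioo_subset_Icc_self ht)).hasDerivAt (Icc_mem_nhds ht.1 ht.2)⟩
  choose z hz0 hz using local_sol
  have agree : ∀ m n : ℕ, m ≤ n → EqOn (z m) (z n) (Ioo (-(m + 1 : ℝ)) (m + 1)) := by
    intro m n hmn
    have hmn' : (m : ℝ) ≤ n := by exact_mod_cast hmn
    have hm : (0 : ℝ) ≤ m := m.cast_nonneg
    refine ODE_solution_unique_of_mem_Ioo (v := F) (s := fun _ => univ) (K := K) (t₀ := 0)
      (fun t _ => (hK t).lipschitzOnWith) ⟨by linarith, by linarith⟩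
      (fun t ht => ⟨hz m t ht, mem_univ _⟩)
      (fun t ht => ⟨hz n t ⟨by linarith [ht.1], by linarith [ht.2]⟩, mem_univ _⟩)
      (by rw [hz0, hz0])
  have mem : ∀ t : ℝ, t ∈ Ioo (-((⌈|t|⌉₊ : ℕ) + 1 : ℝ)) ((⌈|t|⌉₊ : ℕ) + 1) := fun t => by
    have := Nat.le_ceil |t|
    exact ⟨by linarith [neg_abs_le t], by linarith [le_abs_self t]⟩
  refine ⟨fun t => z ⌈|t|⌉₊ t, hz0 _, fun t => ?_⟩
  refine (hz _ t (mem t)).congr_of_eventuallyEq ?_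
  filter_upwards [Ioo_mem_nhds (mem t).1 (mem t).2] with r hr
  rcases le_total ⌈|r|⌉₊ ⌈|t|⌉₊ with h | h
  · exact agree _ _ h (mem r)
  · exact (agree _ _ h hr).symm

/-- Barbalat's lemma for a Lipschitz derivative. -/
lemma tendsto_deriv_zero_of_tendsto {g f : ℝ → ℝ} {l K : ℝ}
    (hg : ∀ t, 0 ≤ t → HasDerivAt g (f t) t) (hl : Tendsto g atTop (nhds l))
    (hf : ∀ s t, 0 ≤ s → 0 ≤ t → |f s - f t| ≤ K * |s - t|) :
    Tendsto f atTop (nhds 0) := by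
  have hK : 0 ≤ K := by simpa using (abs_nonneg _).trans (hf 0 1 le_rfl zero_le_one)
  rw [Metric.tendsto_atTop]
  intro e he
  set δ : ℝ := e / (2 * (K + 1)) with hδ
  have hδ0 : 0 < δ := by positivity
  have hKδ : K * δ ≤ e / 2 := by
    have : (K + 1) * δ = e / 2 := by rw [hδ]; field_simp
    nlinarith
  have hdiff : Tendsto (fun t => g (t + δ) - g t) atTop (nhds 0) := by
    simpa using (hl.comp (tendsto_atTop_add_const_right _ δ tendsto_id)).sub hl
  obtain ⟨N, hN⟩ := Metric.tendsto_atTop.1 hdiff (δ * (e / 2)) (by positivity)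
  refine ⟨max N 0, fun t ht => ?_⟩
  have ht0 : 0 ≤ t := (le_max_right _ _).trans ht
  have h1 := hN t ((le_max_left _ _).trans ht)
  obtain ⟨c, hc, hcd⟩ := exists_hasDerivAt_eq_slope g f (lt_add_of_pos_right t hδ0)
    (fun r hr => (hg r (ht0.trans hr.1)).continuousAt.continuousWithinAt)
    (fun r hr => hg r (ht0.trans hr.1.le))
  rw [add_sub_cancel_left, eq_div_iff hδ0.ne'] at hcd
  rw [Real.dist_eq, sub_zero, ← hcd, abs_mul, abs_of_pos hδ0, mul_comm] at h1
  have h2 : |f c| < e / 2 := lt_of_mul_lt_mul_left h1 hδ0.le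
  have h3 := hf t c ht0 (ht0.trans hc.1.le)
  have h4 : |t - c| ≤ δ := by rw [abs_sub_comm, abs_of_pos (by linarith [hc.1])]; linarith [hc.2]
  have h5 : |f t| ≤ |f t - f c| + |f c| := by simpa using abs_add_le (f t - f c) (f c)
  rw [Real.dist_eq, sub_zero]
  nlinarith [mul_le_mul_of_nonneg_left h4 hK]

lemma exists_lipschitzWith_bound_bump_smul {E : Type*} [NormedAddCommGroup E]
    [NormedSpace ℝ E] [FiniteDimensional ℝ E] [HasContDiffBump E] (χ : ContDiffBump (0 : E))
    {G : E → E} (hG : ContDiff ℝ 1 G) :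
    ∃ K L : NNReal, LipschitzWith K (fun z => χ z • G z) ∧ ∀ z, ‖χ z • G z‖ ≤ L := by
  have hs : HasCompactSupport fun z => χ z • G z := χ.hasCompactSupport.smul_right
  have hcd : ContDiff ℝ 1 fun z => χ z • G z := χ.contDiff.smul hG
  obtain ⟨K, hK⟩ := hcd.lipschitzWith_of_hasCompactSupport hs one_ne_zero
  obtain ⟨L, hL⟩ := hs.exists_bound_of_continuous hcd.continuous
  exact ⟨K, L.toNNReal, hK, fun z => (hL z).trans (Real.le_coe_toNNReal L)⟩

/-- The tracking error dynamics `(p, q, θ)` in the body frame have a global solution, along which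
`p ^ 2 + q ^ 2 + θ ^ 2` decreases. -/
lemma exists_error_solution {s : ℝ → ℝ} (hs : ContDiff ℝ 1 s)
    (hsin : ∀ x, x * s x = Real.sin x) {a b : ℝ → ℝ} (ha : Continuous a) (hb : Continuous b)
    {A B : ℝ} (hA : ∀ t, |a t| ≤ A) (hB : ∀ t, |b t| ≤ B) (p₀ q₀ θ₀ : ℝ) :
    ∃ p q θ : ℝ → ℝ, p 0 = p₀ ∧ q 0 = q₀ ∧ θ 0 = θ₀ ∧
      Antitone (fun t => p t ^ 2 + q t ^ 2 + θ t ^ 2) ∧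
      ∀ t, 0 ≤ t →
        HasDerivAt p ((b t + a t * s (θ t) * q t + θ t) * q t - p t) t ∧
        HasDerivAt q (-(b t + a t * s (θ t) * q t + θ t) * p t + a t * Real.sin (θ t)) t ∧
        HasDerivAt θ (-θ t - a t * s (θ t) * q t) t := by
  set V₀ : ℝ := p₀ ^ 2 + q₀ ^ 2 + θ₀ ^ 2 with hV₀
  have hV₀' : 0 ≤ V₀ := by positivity
  let χ : ContDiffBump (0 : ℝ × ℝ × ℝ) := ⟨V₀ + 1, V₀ + 2, by positivity, by linarith⟩
  let G₀ : ℝ × ℝ × ℝ → ℝ × ℝ × ℝ := fun z =>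
    (z.2.2 * z.2.1 - z.1, -z.2.2 * z.1, -z.2.2)
  let G₁ : ℝ × ℝ × ℝ → ℝ × ℝ × ℝ := fun z =>
    (s z.2.2 * z.2.1 * z.2.1, -(s z.2.2 * z.2.1) * z.1 + Real.sin z.2.2, -(s z.2.2 * z.2.1))
  let G₂ : ℝ × ℝ × ℝ → ℝ × ℝ × ℝ := fun z => (z.2.1, -z.1, 0)
  have hG₀ : ContDiff ℝ 1 G₀ := by fun_prop
  have hG₁ : ContDiff ℝ 1 G₁ := by
    have : ContDiff ℝ 1 Real.sin := Real.contDiff_sin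
    fun_prop
  have hG₂ : ContDiff ℝ 1 G₂ := by fun_prop
  obtain ⟨K₀, L₀, hK₀, hL₀⟩ := exists_lipschitzWith_bound_bump_smul χ hG₀
  obtain ⟨K₁, L₁, hK₁, hL₁⟩ := exists_lipschitzWith_bound_bump_smul χ hG₁
  obtain ⟨K₂, L₂, hK₂, hL₂⟩ := exists_lipschitzWith_bound_bump_smul χ hG₂
  let F : ℝ → ℝ × ℝ × ℝ → ℝ × ℝ × ℝ := fun t z =>
    χ z • G₀ z + (a t • (χ z • G₁ z) + b t • (χ z • G₂ z))
  have hA' : ∀ t, ‖a t‖ ≤ A.toNNReal := fun t => (hA t).trans (Real.le_coe_toNNReal A)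
  have hB' : ∀ t, ‖b t‖ ≤ B.toNNReal := fun t => (hB t).trans (Real.le_coe_toNNReal B)
  have hFK : ∀ t, LipschitzWith (K₀ + (A.toNNReal * K₁ + B.toNNReal * K₂)) (F t) := by
    intro t
    refine hK₀.add (.add ?_ ?_)
    · exact ((lipschitzWith_smul (a t)).comp hK₁).weaken (by gcongr; exact hA' t)
    · exact ((lipschitzWith_smul (b t)).comp hK₂).weaken (by gcongr; exact hB' t)
  have hFL : ∀ t z, ‖F t z‖ ≤ (L₀ + (A.toNNReal * L₁ + B.toNNReal * L₂) : NNReal) := by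
    intro t z
    refine (norm_add_le _ _).trans (add_le_add (hL₀ z) ((norm_add_le _ _).trans ?_))
    rw [norm_smul (a t), norm_smul (b t)]
    exact add_le_add (mul_le_mul (hA' t) (hL₁ z) (norm_nonneg _) NNReal.zero_le_coe)
      (mul_le_mul (hB' t) (hL₂ z) (norm_nonneg _) NNReal.zero_le_coe)
  obtain ⟨z, hz0, hz⟩ := exists_forall_hasDerivAt_of_bounded_lipschitz hFK
    (fun z => by fun_prop) hFL (p₀, q₀, θ₀)
  have hp : ∀ t, HasDerivAt (fun t => (z t).1) (F t (z t)).1 t := fun t => (hz t).fst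
  have hq : ∀ t, HasDerivAt (fun t => (z t).2.1) (F t (z t)).2.1 t := fun t => (hz t).snd.fst
  have hθ : ∀ t, HasDerivAt (fun t => (z t).2.2) (F t (z t)).2.2 t := fun t => (hz t).snd.snd
  have hanti : Antitone fun t => (z t).1 ^ 2 + (z t).2.1 ^ 2 + (z t).2.2 ^ 2 := by
    have hd : ∀ t, HasDerivAt (fun t => (z t).1 ^ 2 + (z t).2.1 ^ 2 + (z t).2.2 ^ 2)
        (-(2 * χ (z t) * ((z t).1 ^ 2 + (z t).2.2 ^ 2))) t := by
      intro t
      refine ((((hp t).pow 2).add ((hq t).pow 2)).add ((hθ t).pow 2)).congr_deriv ?_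
      have := hsin (z t).2.2
      simp only [F, G₀, G₁, G₂, Prod.fst_add, Prod.snd_add, Prod.smul_fst, Prod.smul_snd,
        smul_eq_mul, ← this]
      push_cast
      ring
    refine antitone_of_hasDerivAt_nonpos hd fun t => ?_
    have := χ.nonneg' (z t)
    simp only [Pi.zero_apply]
    have : 0 ≤ 2 * χ (z t) * ((z t).1 ^ 2 + (z t).2.2 ^ 2) := by positivity
    linarith
  refine ⟨fun t => (z t).1, fun t => (z t).2.1, fun t => (z t).2.2, by simp [hz0], by simp [hz0],
    by simp [hz0], hanti, fun t ht => ?_⟩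
  have hχ : χ (z t) = 1 := by
    have hV : (z t).1 ^ 2 + (z t).2.1 ^ 2 + (z t).2.2 ^ 2 ≤ V₀ := by
      simpa [hz0] using hanti ht
    refine χ.one_of_mem_closedBall ?_
    rw [mem_closedBall_zero_iff]
    change ‖z t‖ ≤ V₀ + 1
    have hsq : ∀ x : ℝ, x ^ 2 ≤ V₀ → ‖x‖ ≤ V₀ + 1 := fun x hx =>
      abs_le.2 ⟨by nlinarith, by nlinarith⟩
    simp only [Prod.norm_def, max_le_iff]
    exact ⟨hsq _ (by nlinarith), hsq _ (by nlinarith), hsq _ (by nlinarith)⟩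
  refine ⟨(hp t).congr_deriv ?_, (hq t).congr_deriv ?_, (hθ t).congr_deriv ?_⟩ <;>
  · simp only [F, G₀, G₁, G₂, hχ, Prod.fst_add, Prod.snd_add, Prod.smul_fst, Prod.smul_snd,
      smul_eq_mul]
    ring

lemma exists_abs_le_of_antitone {s p q θ : ℝ → ℝ} (hs : Continuous s)
    (hV : Antitone (fun t => p t ^ 2 + q t ^ 2 + θ t ^ 2)) :
    ∃ R S, 0 ≤ R ∧ 0 ≤ S ∧ (∀ t, 0 ≤ t → |p t| ≤ R ∧ |q t| ≤ R ∧ |θ t| ≤ R) ∧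
      ∀ t, 0 ≤ t → |s (θ t)| ≤ S := by
  obtain ⟨R, hR0, hR⟩ : ∃ R, 0 ≤ R ∧ ∀ t, 0 ≤ t → |p t| ≤ R ∧ |q t| ≤ R ∧ |θ t| ≤ R := by
    refine ⟨p 0 ^ 2 + q 0 ^ 2 + θ 0 ^ 2 + 1, by positivity, fun t ht => ?_⟩
    have h0 := hV ht
    simp only at h0
    have hsq : ∀ x : ℝ, x ^ 2 ≤ p 0 ^ 2 + q 0 ^ 2 + θ 0 ^ 2 →
        |x| ≤ p 0 ^ 2 + q 0 ^ 2 + θ 0 ^ 2 + 1 := fun x hx =>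
      abs_le.2 ⟨by nlinarith, by nlinarith⟩
    exact ⟨hsq _ (by nlinarith), hsq _ (by nlinarith), hsq _ (by nlinarith)⟩
  obtain ⟨S, hS⟩ := (isCompact_Icc (a := -R) (b := R)).exists_bound_of_continuousOn
    hs.continuousOn
  have hS' : ∀ t, 0 ≤ t → |s (θ t)| ≤ S := fun t ht => hS _ (abs_le.1 (hR t ht).2.2)
  exact ⟨R, S, hR0, (abs_nonneg _).trans (hS' 0 le_rfl), hR, hS'⟩

/-- The tracking errors converge to zero when `|a|` is bounded away from zero. -/
lemma tendsto_error_zero {s : ℝ → ℝ} (hs : Continuous s) (hs0 : s 0 = 1)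
    (hsin : ∀ x, x * s x = Real.sin x) {a b : ℝ → ℝ} {A B c ε : ℝ}
    (hA : ∀ t, |a t| ≤ A) (hB : ∀ t, |b t| ≤ B) (hc : 0 < c) (hε : ε = 1 ∨ ε = -1)
    (hac : ∀ t, c ≤ ε * a t) {p q θ : ℝ → ℝ}
    (hV : Antitone (fun t => p t ^ 2 + q t ^ 2 + θ t ^ 2))
    (hp : ∀ t, 0 ≤ t → HasDerivAt p ((b t + a t * s (θ t) * q t + θ t) * q t - p t) t)
    (hq : ∀ t, 0 ≤ t → HasDerivAt q
      (-(b t + a t * s (θ t) * q t + θ t) * p t + a t * Real.sin (θ t)) t)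
    (hθ : ∀ t, 0 ≤ t → HasDerivAt θ (-θ t - a t * s (θ t) * q t) t) :
    Tendsto p atTop (nhds 0) ∧ Tendsto q atTop (nhds 0) ∧ Tendsto θ atTop (nhds 0) := by
  obtain ⟨R, S, hR0, hS0, hR, hS⟩ := exists_abs_le_of_antitone hs hV
  have hA0 : 0 ≤ A := (abs_nonneg _).trans (hA 0)
  have hB0 : 0 ≤ B := (abs_nonneg _).trans (hB 0)
  have hasq : ∀ t, 0 ≤ t → |a t * s (θ t) * q t| ≤ A * S * R := fun t ht => by
    rw [abs_mul, abs_mul]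
    have := hA t; have := hS t ht; have := (hR t ht).2.1
    gcongr
  have hw : ∀ t, 0 ≤ t → |b t + a t * s (θ t) * q t + θ t| ≤ B + A * S * R + R := fun t ht =>
    (abs_add_three _ _ _).trans (add_le_add (add_le_add (hB t) (hasq t ht)) (hR t ht).2.2)
  obtain ⟨l, hl⟩ : ∃ l, Tendsto (fun t => p t ^ 2 + q t ^ 2 + θ t ^ 2) atTop (nhds l) :=
    ⟨_, tendsto_atTop_ciInf hV ⟨0, by rintro _ ⟨t, rfl⟩; positivity⟩⟩
  have hVd : ∀ t, 0 ≤ t → HasDerivAt (fun t => p t ^ 2 + q t ^ 2 + θ t ^ 2)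
      (-2 * (p t ^ 2 + θ t ^ 2)) t := fun t ht => by
    refine ((((hp t ht).pow 2).add ((hq t ht).pow 2)).add ((hθ t ht).pow 2)).congr_deriv ?_
    rw [← hsin]
    push_cast
    ring
  have hfd : ∀ t, 0 ≤ t → HasDerivAt (fun t => -2 * (p t ^ 2 + θ t ^ 2))
      (-4 * (p t * ((b t + a t * s (θ t) * q t + θ t) * q t - p t)
        + θ t * (-θ t - a t * s (θ t) * q t))) t := fun t ht => by
    refine ((((hp t ht).pow 2).add ((hθ t ht).pow 2)).const_mul (-2)).congr_deriv ?_
    push_cast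
    ring
  set K : ℝ := 4 * (R * ((B + A * S * R + R) * R + R) + R * (R + A * S * R)) with hK
  have hlip : ∀ r t, 0 ≤ r → 0 ≤ t →
      |-2 * (p r ^ 2 + θ r ^ 2) - -2 * (p t ^ 2 + θ t ^ 2)| ≤ K * |r - t| := by
    intro r t hr ht
    refine (convex_Ici (0 : ℝ)).norm_image_sub_le_of_norm_hasDerivWithin_le
      (f := fun t => -2 * (p t ^ 2 + θ t ^ 2)) (fun x hx => (hfd x hx).hasDerivWithinAt)
      (fun x hx => ?_) ht hr
    rw [Real.norm_eq_abs, abs_mul, hK, show |(-4 : ℝ)| = 4 by norm_num]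
    obtain ⟨h1, h2, h3⟩ := hR x hx
    have h4 := hw x hx
    have h5 := hasq x hx
    refine mul_le_mul_of_nonneg_left ((abs_add_le _ _).trans ?_) (by norm_num)
    rw [abs_mul, abs_mul]
    have h6 : |(b x + a x * s (θ x) * q x + θ x) * q x - p x| ≤ (B + A * S * R + R) * R + R :=
      (abs_sub _ _).trans (by rw [abs_mul]; gcongr)
    have h7 : |-θ x - a x * s (θ x) * q x| ≤ R + A * S * R :=
      (abs_sub _ _).trans (by rw [abs_neg]; gcongr)
    gcongr
  have hf := tendsto_deriv_zero_of_tendsto hVd hl hlip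
  have hpθ : Tendsto (fun t => p t ^ 2 + θ t ^ 2) atTop (nhds 0) := by
    have := hf.const_mul (-1 / 2)
    rw [mul_zero] at this
    exact this.congr fun t => by ring
  have of_sq : ∀ f : ℝ → ℝ, Tendsto (fun t => f t ^ 2) atTop (nhds 0) →
      Tendsto f atTop (nhds 0) := fun f h => by
    rw [tendsto_zero_iff_abs_tendsto_zero]
    simpa [Function.comp_def, Real.sqrt_sq_eq_abs] using h.sqrt
  have hp0 : Tendsto p atTop (nhds 0) := of_sq _ <|
    squeeze_zero (fun t => sq_nonneg _) (fun t => le_add_of_nonneg_right (sq_nonneg _)) hpθ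
  have hθ0 : Tendsto θ atTop (nhds 0) := of_sq _ <|
    squeeze_zero (fun t => sq_nonneg _) (fun t => le_add_of_nonneg_left (sq_nonneg _)) hpθ
  have hq2 : Tendsto (fun t => q t ^ 2) atTop (nhds l) := by
    have := hl.sub hpθ
    rw [sub_zero] at this
    exact this.congr fun t => by ring
  have hl0 : 0 ≤ l := ge_of_tendsto' hq2 fun t => sq_nonneg _
  refine ⟨hp0, of_sq _ ?_, hθ0⟩
  rcases hl0.eq_or_lt with rfl | hlpos
  · exact hq2
  exfalso
  have hbdd : ∀ {f g : ℝ → ℝ} {C : ℝ}, Tendsto f atTop (nhds 0) → (∀ t, 0 ≤ t → |g t| ≤ C) →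
      Tendsto (fun t => f t * g t) atTop (nhds 0) := fun hf hg =>
    hf.zero_mul_isBoundedUnder_le <| isBoundedUnder_of_eventually_le <|
      (eventually_ge_atTop 0).mono hg
  have hεabs : |ε| = 1 := by rcases hε with rfl | rfl <;> simp
  have hW : Tendsto (fun t => θ t * (ε * q t)) atTop (nhds 0) :=
    hbdd hθ0 (C := R) fun t ht => by rw [abs_mul, hεabs, one_mul]; exact (hR t ht).2.1
  have hr : Tendsto (fun t => θ t * (ε * (-q t - (b t + a t * s (θ t) * q t + θ t) * p t
      + a t * Real.sin (θ t)))) atTop (nhds 0) := by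
    refine hbdd hθ0 (C := R + (B + A * S * R + R) * R + A * 1) fun t ht => ?_
    obtain ⟨h1, h2, h3⟩ := hR t ht
    have h4 := hw t ht
    have h5 := hA t
    have h6 := Real.abs_sin_le_one (θ t)
    rw [abs_mul, hεabs, one_mul]
    refine (abs_add_le _ _).trans (add_le_add ((abs_sub _ _).trans (add_le_add ?_ ?_)) ?_)
    · rwa [abs_neg]
    · rw [abs_mul]; gcongr
    · rw [abs_mul]; gcongr
  have hWd : ∀ t, 0 ≤ t → HasDerivAt (fun t => θ t * (ε * q t))
      (-(ε * a t * s (θ t) * q t ^ 2) + θ t * (ε * (-q t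
        - (b t + a t * s (θ t) * q t + θ t) * p t + a t * Real.sin (θ t)))) t := fun t ht => by
    refine ((hθ t ht).mul ((hq t ht).const_mul ε)).congr_deriv ?_
    ring
  have hsθ : Tendsto (fun t => s (θ t)) atTop (nhds 1) :=
    hs0 ▸ (hs.tendsto 0).comp hθ0
  have hev : ∀ᶠ t in atTop, 0 ≤ t ∧ 1 / 2 < s (θ t) ∧ l / 2 < q t ^ 2 ∧
      θ t * (ε * (-q t - (b t + a t * s (θ t) * q t + θ t) * p t
        + a t * Real.sin (θ t))) < c * l / 8 :=
    (eventually_ge_atTop 0).and <| (hsθ.eventually_const_lt (by norm_num)).and <|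
      (hq2.eventually_const_lt (by linarith)).and <| hr.eventually_lt_const (by positivity)
  obtain ⟨T, hT⟩ := eventually_atTop.1 hev
  have hder : ∀ t, T ≤ t → -(ε * a t * s (θ t) * q t ^ 2) + θ t * (ε * (-q t
        - (b t + a t * s (θ t) * q t + θ t) * p t + a t * Real.sin (θ t))) ≤ -(c * l / 8) := by
    intro t ht
    obtain ⟨-, h1, h2, h3⟩ := hT t ht
    have h4 : c * (1 / 2) * (l / 2) ≤ ε * a t * s (θ t) * q t ^ 2 := by
      have h5 := hac t
      have h6 := hc.le.trans h5
      gcongr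
    linarith
  have hstep : Tendsto (fun t => θ (t + 1) * (ε * q (t + 1)) - θ t * (ε * q t)) atTop (nhds 0) := by
    simpa using (hW.comp (tendsto_atTop_add_const_right _ 1 tendsto_id)).sub hW
  obtain ⟨t, ht, hTt⟩ := ((hstep.eventually_const_lt
    (show -(c * l / 8) < 0 by have := mul_pos hc hlpos; linarith)).and
    (eventually_ge_atTop T)).exists
  have h0 := (hT t hTt).1
  obtain ⟨x, hx, hxd⟩ := exists_hasDerivAt_eq_slope _ _ (lt_add_one t)
    (fun r hr => (hWd r (h0.trans hr.1)).continuousAt.continuousWithinAt)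
    (fun r hr => hWd r (h0.trans hr.1.le))
  have h1 := hder x (hTt.trans hx.1.le)
  rw [hxd, add_sub_cancel_left, div_one] at h1
  linarith

/-- Global stabilization of every strongly admissible reference trajectory of the
Chaplygin sled `ẋ₁ = u₁ cos y₁, ẋ₂ = u₁ sin y₁, ẏ₁ = u₂` by a single continuous
memoryless feedback `Φ` defined on the whole configuration space `ℝ³`. -/
theorem stmt18 :
    ∃ Φ : (ℝ × ℝ × ℝ) × (ℝ × ℝ × ℝ) × (ℝ × ℝ) → ℝ × ℝ,
      ContinuousOn Φ {q | q.2.2.1 ≠ 0} ∧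
      -- for every strongly admissible reference trajectory `xD = (xD₁, xD₂)`,
      -- given with its first derivatives `d₁, d₂` and second derivatives `dd₁, dd₂`
      ∀ xD₁ xD₂ d₁ d₂ dd₁ dd₂ : ℝ → ℝ,
        (∀ t ∈ Ici (0:ℝ), HasDerivWithinAt xD₁ (d₁ t) (Ici 0) t) →
        (∀ t ∈ Ici (0:ℝ), HasDerivWithinAt xD₂ (d₂ t) (Ici 0) t) →
        (∀ t ∈ Ici (0:ℝ), HasDerivWithinAt d₁ (dd₁ t) (Ici 0) t) →
        (∀ t ∈ Ici (0:ℝ), HasDerivWithinAt d₂ (dd₂ t) (Ici 0) t) →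
        ContinuousOn dd₁ (Ici 0) → ContinuousOn dd₂ (Ici 0) →
        -- `ẋᴰ` and `ẍᴰ` bounded
        (∃ C, ∀ t ∈ Ici (0:ℝ), Real.sqrt (d₁ t ^ 2 + d₂ t ^ 2) ≤ C) →
        (∃ C, ∀ t ∈ Ici (0:ℝ), Real.sqrt (dd₁ t ^ 2 + dd₂ t ^ 2) ≤ C) →
        -- `inf_{t ≥ 0} |ẋᴰ(t)| > 0`
        (∃ c > 0, ∀ t ∈ Ici (0:ℝ), c ≤ Real.sqrt (d₁ t ^ 2 + d₂ t ^ 2)) →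
        ∀ ε : ℝ, (ε = 1 ∨ ε = -1) →
        ∀ u₁D : ℝ → ℝ, (∀ t, u₁D t = ε * Real.sqrt (d₁ t ^ 2 + d₂ t ^ 2)) →
        -- `y₁D` is any `C¹` heading with `ẋᴰ = u₁D (cos y₁D, sin y₁D)`, `u₂D = ẏ₁D`
        ∀ y₁D u₂D : ℝ → ℝ,
          (∀ t ∈ Ici (0:ℝ), HasDerivWithinAt y₁D (u₂D t) (Ici 0) t) →
          ContinuousOn u₂D (Ici 0) →
          (∀ t ∈ Ici (0:ℝ),
            d₁ t = u₁D t * Real.cos (y₁D t) ∧ d₂ t = u₁D t * Real.sin (y₁D t)) →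
          -- for every initial state the closed-loop solution exists for all `t ≥ 0`,
          -- has bounded input, and tracks the reference
          ∀ x₁0 x₂0 y₁0 : ℝ,
            ∃ x₁ x₂ y₁ : ℝ → ℝ, ∃ u : ℝ → ℝ × ℝ,
              x₁ 0 = x₁0 ∧ x₂ 0 = x₂0 ∧ y₁ 0 = y₁0 ∧
              (∀ t ∈ Ici (0:ℝ),
                u t = Φ ((x₁ t, x₂ t, y₁ t), (xD₁ t, xD₂ t, y₁D t), (u₁D t, u₂D t))) ∧
              (∀ t ∈ Ici (0:ℝ),
                HasDerivWithinAt x₁ ((u t).1 * Real.cos (y₁ t)) (Ici 0) t ∧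
                HasDerivWithinAt x₂ ((u t).1 * Real.sin (y₁ t)) (Ici 0) t ∧
                HasDerivWithinAt y₁ ((u t).2) (Ici 0) t) ∧
              (∃ C, ∀ t ∈ Ici (0:ℝ), ‖u t‖ ≤ C) ∧
              Tendsto (fun t => x₁ t - xD₁ t) atTop (nhds 0) ∧
              Tendsto (fun t => x₂ t - xD₂ t) atTop (nhds 0) ∧
              Tendsto (fun t => y₁ t - y₁D t) atTop (nhds 0) ∧
              Tendsto (fun t => u t - (u₁D t, u₂D t)) atTop (nhds 0) := by
  obtain ⟨s, hs, hsin, hs0⟩ := exists_contDiff_mul_eq_sin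
  have hsc := hs.continuous
  refine ⟨fun z =>
    (z.2.2.1 * Real.cos (z.2.1.2.2 - z.1.2.2) + (Real.cos z.1.2.2 * (z.2.1.1 - z.1.1)
        + Real.sin z.1.2.2 * (z.2.1.2.1 - z.1.2.1)),
      z.2.2.2 + z.2.2.1 * s (z.2.1.2.2 - z.1.2.2) * (-Real.sin z.1.2.2 * (z.2.1.1 - z.1.1)
        + Real.cos z.1.2.2 * (z.2.1.2.1 - z.1.2.1)) + (z.2.1.2.2 - z.1.2.2)),
    Continuous.continuousOn (by fun_prop), ?_⟩
  intro xD₁ xD₂ d₁ d₂ dd₁ dd₂ hx₁ hx₂ hd₁ hd₂ _ _ ⟨A, hA⟩ ⟨D, hD⟩ ⟨c, hc, hcd⟩ ε hε u₁D hu₁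
    y₁D u₂D hy hu₂ hdir x₁0 x₂0 y₁0
  have hεsq : ε * ε = 1 := by rcases hε with rfl | rfl <;> norm_num
  have hεabs : |ε| = 1 := by rcases hε with rfl | rfl <;> simp
  have hd₁c : ContinuousOn d₁ (Ici 0) := fun t ht => (hd₁ t ht).continuousWithinAt
  have hd₂c : ContinuousOn d₂ (Ici 0) := fun t ht => (hd₂ t ht).continuousWithinAt
  have hu₁c : ContinuousOn u₁D (Ici 0) := by
    rw [funext hu₁]
    exact continuousOn_const.mul ((hd₁c.pow 2).add (hd₂c.pow 2)).sqrt
  have hu₁abs : ∀ t, |u₁D t| = Real.sqrt (d₁ t ^ 2 + d₂ t ^ 2) := fun t => by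
    rw [hu₁, abs_mul, hεabs, one_mul, abs_of_nonneg (Real.sqrt_nonneg _)]
  have hu₂b : ∀ t ∈ Ici (0 : ℝ), |u₂D t| ≤ 2 * D / c := by
    intro t ht
    have hE : HasDerivWithinAt
        (fun r => -(Real.sin (y₁D r) * d₁ r) + Real.cos (y₁D r) * d₂ r)
        (-(Real.cos (y₁D t) * u₂D t * d₁ t + Real.sin (y₁D t) * dd₁ t)
          + (-Real.sin (y₁D t) * u₂D t * d₂ t + Real.cos (y₁D t) * dd₂ t)) (Ici 0) t :=
      ((hy t ht).sin.mul (hd₁ t ht)).neg.add ((hy t ht).cos.mul (hd₂ t ht))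
    have hE0 : HasDerivWithinAt
        (fun r => -(Real.sin (y₁D r) * d₁ r) + Real.cos (y₁D r) * d₂ r) 0 (Ici 0) t :=
      (hasDerivWithinAt_const t (Ici (0 : ℝ)) (0 : ℝ)).congr_of_mem
        (fun r hr => by rw [(hdir r hr).1, (hdir r hr).2]; ring) ht
    have heq := (uniqueDiffOn_Ici (0 : ℝ) t ht).eq_deriv _ hE hE0
    have hmul : u₂D t * u₁D t = -(Real.sin (y₁D t) * dd₁ t) + Real.cos (y₁D t) * dd₂ t := by
      rw [(hdir t ht).1, (hdir t ht).2] at heq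
      linear_combination -heq - u₂D t * u₁D t * Real.sin_sq_add_cos_sq (y₁D t)
    have h1 : |dd₁ t| ≤ D := (Real.abs_le_sqrt (by nlinarith [sq_nonneg (dd₂ t)])).trans (hD t ht)
    have h2 : |dd₂ t| ≤ D := (Real.abs_le_sqrt (by nlinarith [sq_nonneg (dd₁ t)])).trans (hD t ht)
    have h3 : |u₂D t| * |u₁D t| ≤ 1 * D + 1 * D := by
      rw [← abs_mul, hmul]
      refine (abs_add_le _ _).trans ?_
      rw [abs_neg, abs_mul, abs_mul]
      have := Real.abs_sin_le_one (y₁D t)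
      have := Real.abs_cos_le_one (y₁D t)
      gcongr
    rw [le_div_iff₀ hc]
    have h4 := hcd t ht
    rw [← hu₁abs] at h4
    have := mul_le_mul_of_nonneg_left h4 (abs_nonneg (u₂D t))
    linarith
  have hmem : ∀ t : ℝ, max t 0 ∈ Ici (0 : ℝ) := fun t => mem_Ici.2 (le_max_right t 0)
  set a : ℝ → ℝ := fun t => u₁D (max t 0) with ha
  set b : ℝ → ℝ := fun t => u₂D (max t 0) with hb
  have hac : Continuous a := hu₁c.comp_continuous (by fun_prop) hmem
  have hbc : Continuous b := hu₂.comp_continuous (by fun_prop) hmem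
  have haA : ∀ t, |a t| ≤ A := fun t => (hu₁abs _).trans_le (hA _ (hmem t))
  have hbB : ∀ t, |b t| ≤ 2 * D / c := fun t => hu₂b _ (hmem t)
  have hca : ∀ t, c ≤ ε * a t := fun t => by
    simp only [ha]
    rw [hu₁, ← mul_assoc, hεsq, one_mul]
    exact hcd _ (hmem t)
  have ha_eq : ∀ t ∈ Ici (0 : ℝ), a t = u₁D t := fun t ht => by simp only [ha, max_eq_left (mem_Ici.1 ht)]
  have hb_eq : ∀ t ∈ Ici (0 : ℝ), b t = u₂D t := fun t ht => by simp only [hb, max_eq_left (mem_Ici.1 ht)]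
  obtain ⟨p, q, θ, hp0, hq0, hθ0, hV, hode⟩ := exists_error_solution hs hsin hac hbc haA hbB
    (Real.cos y₁0 * (xD₁ 0 - x₁0) + Real.sin y₁0 * (xD₂ 0 - x₂0))
    (-Real.sin y₁0 * (xD₁ 0 - x₁0) + Real.cos y₁0 * (xD₂ 0 - x₂0)) (y₁D 0 - y₁0)
  obtain ⟨hp, hq, hθ⟩ := tendsto_error_zero hsc hs0 hsin haA hbB hc hε hca hV
    (fun t ht => (hode t ht).1) (fun t ht => (hode t ht).2.1) (fun t ht => (hode t ht).2.2)
  obtain ⟨R, S, hR0, hS0, hR, hS⟩ := exists_abs_le_of_antitone hsc hV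
  have hbdd : ∀ {f g : ℝ → ℝ} {C : ℝ}, Tendsto f atTop (nhds 0) → (∀ t, |g t| ≤ C) →
      Tendsto (fun t => g t * f t) atTop (nhds 0) := fun hf hg =>
    isBoundedUnder_le_mul_tendsto_zero (isBoundedUnder_of ⟨_, hg⟩) hf
  have hcosb : ∀ t, |Real.cos (y₁D t - θ t)| ≤ 1 := fun t => Real.abs_cos_le_one _
  have hsinb : ∀ t, |Real.sin (y₁D t - θ t)| ≤ 1 := fun t => Real.abs_sin_le_one _
  refine ⟨fun t => xD₁ t - (Real.cos (y₁D t - θ t) * p t - Real.sin (y₁D t - θ t) * q t),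
    fun t => xD₂ t - (Real.sin (y₁D t - θ t) * p t + Real.cos (y₁D t - θ t) * q t),
    fun t => y₁D t - θ t,
    fun t => (a t * Real.cos (θ t) + p t, b t + a t * s (θ t) * q t + θ t),
    ?_, ?_, ?_, ?_, ?_, ?_, ?_, ?_, ?_, ?_⟩
  · simp only [hp0, hq0, hθ0, sub_sub_cancel]
    linear_combination (x₁0 - xD₁ 0) * Real.sin_sq_add_cos_sq y₁0
  · simp only [hp0, hq0, hθ0, sub_sub_cancel]
    linear_combination (x₂0 - xD₂ 0) * Real.sin_sq_add_cos_sq y₁0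
  · simp only [hθ0, sub_sub_cancel]
  · intro t ht
    have hsc2 := Real.sin_sq_add_cos_sq (y₁D t - θ t)
    simp only [ha_eq t ht, hb_eq t ht, sub_sub_cancel]
    refine Prod.ext ?_ ?_
    · simp only
      linear_combination (-p t) * hsc2
    · simp only
      linear_combination (-(u₁D t * s (θ t) * q t)) * hsc2
  · intro t ht
    obtain ⟨hp', hq', hθ'⟩ := hode t ht
    have hya : HasDerivWithinAt (fun t => y₁D t - θ t) (b t + a t * s (θ t) * q t + θ t)
        (Ici 0) t := by
      refine ((hy t ht).sub hθ'.hasDerivWithinAt).congr_deriv ?_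
      rw [hb_eq t ht]
      ring
    have hY : y₁D t = (y₁D t - θ t) + θ t := by ring
    refine ⟨?_, ?_, hya⟩
    · refine ((hx₁ t ht).sub ((hya.cos.mul hp'.hasDerivWithinAt).sub
        (hya.sin.mul hq'.hasDerivWithinAt))).congr_deriv ?_
      rw [(hdir t ht).1, ← ha_eq t ht, hY, Real.cos_add, ← hY]
      ring
    · refine ((hx₂ t ht).sub ((hya.sin.mul hp'.hasDerivWithinAt).add
        (hya.cos.mul hq'.hasDerivWithinAt))).congr_deriv ?_
      rw [(hdir t ht).2, ← ha_eq t ht, hY, Real.sin_add, ← hY]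
      ring
  · refine ⟨max (A * 1 + R) (2 * D / c + A * S * R + R), fun t ht => ?_⟩
    obtain ⟨h1, h2, h3⟩ := hR t ht
    have h4 := hS t ht
    have h5 := haA t
    have h6 := Real.abs_cos_le_one (θ t)
    have hA0 := (abs_nonneg _).trans h5
    refine max_le_max ?_ ?_
    · refine (abs_add_le _ _).trans (add_le_add ?_ h1)
      rw [abs_mul]
      gcongr
    · refine (abs_add_three _ _ _).trans (add_le_add (add_le_add (hbB t) ?_) h3)
      rw [abs_mul, abs_mul]
      gcongr
  · simpa using ((hbdd hp hcosb).sub (hbdd hq hsinb)).neg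
  · simpa [add_comm] using ((hbdd hp hsinb).add (hbdd hq hcosb)).neg
  · simpa using hθ.neg
  · have hcos : Tendsto (fun t => Real.cos (θ t) - 1) atTop (nhds 0) := by
      simpa using ((Real.continuous_cos.tendsto 0).comp hθ).sub_const 1
    have hsq : Tendsto (fun t => s (θ t) * q t) atTop (nhds 0) := by
      simpa using ((hsc.tendsto 0).comp hθ).mul hq
    have h1 : Tendsto (fun t => a t * (Real.cos (θ t) - 1) + p t) atTop (nhds 0) := by
      simpa using (hbdd hcos haA).add hp
    have h2 : Tendsto (fun t => a t * (s (θ t) * q t) + θ t) atTop (nhds 0) := by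
      simpa using (hbdd hsq haA).add hθ
    refine (h1.prodMk_nhds h2).congr' ?_
    filter_upwards [eventually_ge_atTop 0] with t ht
    rw [← ha_eq t ht, ← hb_eq t ht]
    refine Prod.ext ?_ ?_
    · simp only [Prod.fst_sub]
      ring
    · simp only [Prod.snd_sub]
      ring
end

section
/- Consider the kinematic model of an automobile with unit base length: ẋ₁ = u₁ cos y₁, ẋ₂ = u₁ sin y₁, ẏ₁ = u₁ tan y₂, ẏ₂ = u₂. For every x^D ∈ C³([0,∞), ℝ²) with inf_{t≥0} |ẋ^D(t)| > 0 and every ε ∈ {−1,1}, there exist y^D = (y₁^D, y₂^D) ∈ C¹([0,∞), ℝ²) with |y₂^D(t)| < π/2 for all t, and a continuous u^D : [0,∞) → ℝ² with sign u₁^D(t) = ε, such that ẋ₁^D = u₁^D cos y₁^D, ẋ₂^D = u₁^D sin y₁^D, ẏ₁^D = u₁^D tan y₂^D, and ẏ₂^D = u₂^D hold for all t ≥ 0. -/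
open Set

/-- A curve `(a, b)` on `[0, ∞)` that starts on the unit circle and rotates with continuous angular
velocity `w` has an angle function with derivative `w`. -/
lemma exists_angle_of_rotation {a b w : ℝ → ℝ} (hw : ContinuousOn w (Ici 0))
    (ha : ∀ t ∈ Ici (0 : ℝ), HasDerivWithinAt a (-(w t * b t)) (Ici 0) t)
    (hb : ∀ t ∈ Ici (0 : ℝ), HasDerivWithinAt b (w t * a t) (Ici 0) t)
    (h0 : a 0 ^ 2 + b 0 ^ 2 = 1) :
    ∃ y : ℝ → ℝ, (∀ t ∈ Ici (0 : ℝ), HasDerivWithinAt y (w t) (Ici 0) t) ∧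
      ∀ t ∈ Ici (0 : ℝ), a t = Real.cos (y t) ∧ b t = Real.sin (y t) := by
  obtain ⟨θ, hθa, hθb⟩ : ∃ θ : ℝ, a 0 = Real.cos θ ∧ b 0 = Real.sin θ := by
    have hn : ‖(⟨a 0, b 0⟩ : ℂ)‖ = 1 := by
      rw [Complex.norm_eq_sqrt_sq_add_sq, h0, Real.sqrt_one]
    refine ⟨Complex.arg ⟨a 0, b 0⟩, ?_, ?_⟩
    · rw [Complex.cos_arg (norm_ne_zero_iff.1 (by simp [hn])), hn, div_one]
    · rw [Complex.sin_arg, hn, div_one]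
  have hW : Continuous fun s : ℝ => w (max s 0) :=
    hw.comp_continuous (by fun_prop) fun s => le_max_right s 0
  set y : ℝ → ℝ := fun t => θ + ∫ s in (0 : ℝ)..t, w (max s 0) with hy
  have hyd : ∀ t ∈ Ici (0 : ℝ), HasDerivWithinAt y (w t) (Ici 0) t := fun t ht => by
    have h := ((hW.integral_hasStrictDerivAt 0 t).hasDerivAt.const_add θ).hasDerivWithinAt
      (s := Ici 0)
    rwa [max_eq_left (mem_Ici.1 ht)] at h
  have hy0 : y 0 = θ := by simp [hy]
  have const_of_deriv_zero : ∀ f : ℝ → ℝ,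
      (∀ t ∈ Ici (0 : ℝ), HasDerivWithinAt f 0 (Ici 0) t) → ∀ t ∈ Ici (0 : ℝ), f t = f 0 := by
    intro f hf t ht
    refine constant_of_has_deriv_right_zero (a := 0) (b := t)
      (fun s hs => ((hf s hs.1).continuousWithinAt).mono Icc_subset_Ici_self)
      (fun s hs => (hf s hs.1).mono (Ici_subset_Ici.2 hs.1)) t ⟨ht, le_rfl⟩
  have hE := const_of_deriv_zero (fun t => a t * Real.cos (y t) + b t * Real.sin (y t))
    fun t ht => by
      refine (((ha t ht).mul (hyd t ht).cos).add ((hb t ht).mul (hyd t ht).sin)).congr_deriv ?_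
      ring
  have hF := const_of_deriv_zero (fun t => b t * Real.cos (y t) - a t * Real.sin (y t))
    fun t ht => by
      refine (((hb t ht).mul (hyd t ht).cos).sub ((ha t ht).mul (hyd t ht).sin)).congr_deriv ?_
      ring
  refine ⟨y, hyd, fun t ht => ?_⟩
  have e := hE t ht
  have f := hF t ht
  have s0 := Real.sin_sq_add_cos_sq θ
  have s := Real.sin_sq_add_cos_sq (y t)
  simp only [hy0, hθa, hθb] at e f
  constructor
  · linear_combination Real.cos (y t) * e - Real.sin (y t) * f - a t * s + Real.cos (y t) * s0
  · linear_combination Real.sin (y t) * e + Real.cos (y t) * f - b t * s + Real.sin (y t) * s0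

/-- Maneuverability of the automobile with unit base length on the region
`|y₂| < π/2`: every planar `C³` reference trajectory with speed bounded away from
zero can be followed exactly, forward (`ε = 1`) or backward (`ε = −1`). -/
theorem stmt19
    -- `xD = (xD₁, xD₂)` is `C³` on `[0,∞)`, given with its first derivatives
    -- `d₁, d₂`, second derivatives `dd₁, dd₂` and third derivatives `ddd₁, ddd₂`
    (xD₁ xD₂ d₁ d₂ dd₁ dd₂ ddd₁ ddd₂ : ℝ → ℝ)
    (hd₁ : ∀ t ∈ Ici (0:ℝ), HasDerivWithinAt xD₁ (d₁ t) (Ici 0) t)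
    (hd₂ : ∀ t ∈ Ici (0:ℝ), HasDerivWithinAt xD₂ (d₂ t) (Ici 0) t)
    (hdd₁ : ∀ t ∈ Ici (0:ℝ), HasDerivWithinAt d₁ (dd₁ t) (Ici 0) t)
    (hdd₂ : ∀ t ∈ Ici (0:ℝ), HasDerivWithinAt d₂ (dd₂ t) (Ici 0) t)
    (hddd₁ : ∀ t ∈ Ici (0:ℝ), HasDerivWithinAt dd₁ (ddd₁ t) (Ici 0) t)
    (hddd₂ : ∀ t ∈ Ici (0:ℝ), HasDerivWithinAt dd₂ (ddd₂ t) (Ici 0) t)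
    (hc₁ : ContinuousOn ddd₁ (Ici 0)) (hc₂ : ContinuousOn ddd₂ (Ici 0))
    -- `inf_{t ≥ 0} |ẋᴰ(t)| > 0`
    (hinf : ∃ c > 0, ∀ t ∈ Ici (0:ℝ), c ≤ Real.sqrt (d₁ t ^ 2 + d₂ t ^ 2))
    (ε : ℝ) (hε : ε = 1 ∨ ε = -1) :
    ∃ y₁D y₂D : ℝ → ℝ, ∃ u₁D u₂D : ℝ → ℝ,
      (∀ t ∈ Ici (0:ℝ), |y₂D t| < Real.pi / 2) ∧
      ContinuousOn u₁D (Ici 0) ∧ ContinuousOn u₂D (Ici 0) ∧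
      -- `sign u₁D(t) = ε`
      (∀ t ∈ Ici (0:ℝ), 0 < ε * u₁D t) ∧
      (∀ t ∈ Ici (0:ℝ),
        d₁ t = u₁D t * Real.cos (y₁D t) ∧
        d₂ t = u₁D t * Real.sin (y₁D t)) ∧
      (∀ t ∈ Ici (0:ℝ),
        HasDerivWithinAt y₁D (u₁D t * Real.tan (y₂D t)) (Ici 0) t ∧
        HasDerivWithinAt y₂D (u₂D t) (Ici 0) t) := by
  obtain ⟨c, hc, hspeed⟩ := hinf
  have hε2 : ε ^ 2 = 1 := by rcases hε with rfl | rfl <;> norm_num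
  set v : ℝ → ℝ := fun t => ε * Real.sqrt (d₁ t ^ 2 + d₂ t ^ 2) with hv
  have hpos : ∀ t ∈ Ici (0 : ℝ), 0 < ε * v t := fun t ht => by
    have h : ε * v t = Real.sqrt (d₁ t ^ 2 + d₂ t ^ 2) := by
      simp only [hv]; linear_combination Real.sqrt (d₁ t ^ 2 + d₂ t ^ 2) * hε2
    rw [h]
    exact hc.trans_le (hspeed t ht)
  have hv0 : ∀ t ∈ Ici (0 : ℝ), v t ≠ 0 := fun t ht => right_ne_zero_of_mul (hpos t ht).ne'
  have hv2 : ∀ t, v t ^ 2 = d₁ t ^ 2 + d₂ t ^ 2 := fun t => by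
    simp only [hv]
    rw [mul_pow, hε2, Real.sq_sqrt (by positivity), one_mul]
  have hvd : ∀ t ∈ Ici (0 : ℝ),
      HasDerivWithinAt v ((d₁ t * dd₁ t + d₂ t * dd₂ t) / v t) (Ici 0) t := fun t ht => by
    have hs : 0 < Real.sqrt (d₁ t ^ 2 + d₂ t ^ 2) := hc.trans_le (hspeed t ht)
    have hε0 : ε ≠ 0 := by rintro rfl; norm_num at hε2
    refine (((((hdd₁ t ht).pow 2).add ((hdd₂ t ht).pow 2)).sqrt
      (Real.sqrt_pos.1 hs).ne').const_mul ε).congr_deriv ?_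
    simp only [hv, Pi.add_apply, Pi.pow_apply]
    field_simp
    rw [hε2]
    push_cast
    ring
  have hcont : ∀ {f f' : ℝ → ℝ}, (∀ t ∈ Ici (0 : ℝ), HasDerivWithinAt f (f' t) (Ici 0) t) →
      ContinuousOn f (Ici 0) := fun h t ht => (h t ht).continuousWithinAt
  have cd₁ := hcont hdd₁
  have cd₂ := hcont hdd₂
  have cdd₁ := hcont hddd₁
  have cdd₂ := hcont hddd₂
  have cv := hcont hvd
  set N : ℝ → ℝ := fun t => d₁ t * dd₂ t - d₂ t * dd₁ t with hN
  have cN : ContinuousOn N (Ici 0) := (cd₁.mul cdd₂).sub (cd₂.mul cdd₁)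
  have hNd : ∀ t ∈ Ici (0 : ℝ),
      HasDerivWithinAt N (d₁ t * ddd₂ t - d₂ t * ddd₁ t) (Ici 0) t := fun t ht => by
    refine (((hdd₁ t ht).mul (hddd₂ t ht)).sub ((hdd₂ t ht).mul (hddd₁ t ht))).congr_deriv ?_
    ring
  obtain ⟨y, hyd, hy⟩ := exists_angle_of_rotation (a := fun t => d₁ t / v t)
    (b := fun t => d₂ t / v t) (w := fun t => N t / v t ^ 2)
    (cN.div (cv.pow 2) fun t ht => pow_ne_zero 2 (hv0 t ht))
    (fun t ht => by
      have h0 := hv0 t ht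
      refine ((hdd₁ t ht).div (hvd t ht) h0).congr_deriv ?_
      simp only [hN]
      field_simp
      rw [hv2]
      ring)
    (fun t ht => by
      have h0 := hv0 t ht
      refine ((hdd₂ t ht).div (hvd t ht) h0).congr_deriv ?_
      simp only [hN]
      field_simp
      rw [hv2]
      ring)
    (by
      have h0 := hv0 0 self_mem_Ici
      rw [div_pow, div_pow, ← add_div, ← hv2, div_self (pow_ne_zero 2 h0)])
  have hκd : ∀ t ∈ Ici (0 : ℝ), HasDerivWithinAt (fun t => Real.arctan (N t / v t ^ 3)) _
      (Ici 0) t := fun t ht =>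
    ((hNd t ht).div ((hvd t ht).pow 3) (pow_ne_zero 3 (hv0 t ht))).arctan
  refine ⟨y, fun t => Real.arctan (N t / v t ^ 3), v, _,
    fun t _ => abs_lt.2 ⟨Real.neg_pi_div_two_lt_arctan _, Real.arctan_lt_pi_div_two _⟩,
    cv, ?_, hpos, fun t ht => ⟨?_, ?_⟩, fun t ht => ⟨?_, hκd t ht⟩⟩
  · have cκ : ContinuousOn (fun t => N t / v t ^ 3) (Ici 0) :=
      cN.div (cv.pow 3) fun t ht => pow_ne_zero 3 (hv0 t ht)
    refine ContinuousOn.mul (continuousOn_const.div (continuousOn_const.add (cκ.pow 2))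
      fun t _ => by positivity) (ContinuousOn.div ?_ ((cv.pow 3).pow 2)
        fun t ht => pow_ne_zero 2 (pow_ne_zero 3 (hv0 t ht)))
    exact (((cd₁.mul hc₂).sub (cd₂.mul hc₁)).mul (cv.pow 3)).sub
      (cN.mul ((continuousOn_const.mul (cv.pow 2)).mul
        (((cd₁.mul cdd₁).add (cd₂.mul cdd₂)).div cv hv0)))
  · rw [← (hy t ht).1, mul_div_cancel₀ _ (hv0 t ht)]
  · rw [← (hy t ht).2, mul_div_cancel₀ _ (hv0 t ht)]
  · refine (hyd t ht).congr_deriv ?_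
    have h0 := hv0 t ht
    rw [Real.tan_arctan]
    field_simp
end
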